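/- For any pair of finite simple graphs G and H, the domination number of their Cartesian product satisfies γ(G □ H) ≥ (1/2)·γ(G)·γ(H). -/

import Mathlib

open SimpleGraph

/-- `D` is a dominating set of `G`: every vertex lies in the closed
neighborhood of some vertex of `D`. -/
def IsDominating {V : Type*} (G : SimpleGraph V) (D : Set V) : Prop :=
  ∀ v : V, ∃ d ∈ D, v = d ∨ G.Adj d v

/-- The domination number of a finite graph: the minimum cardinality of a
dominating set. -/
noncomputable def dominationNumber (V : Type*) [Fintype V] (G : SimpleGraph V) : ℕ :=
  sInf {n : ℕ | ∃ D : Finset V, IsDominating G ↑D ∧ D.card = n}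

/-- The closed neighborhood `N_G[P]` of a set of vertices `P`. -/
def closedNbhd {V : Type*} (G : SimpleGraph V) (P : Set V) : Set V :=
  ⋃ p ∈ P, insert p (G.neighborSet p)

theorem dominationNumber_le_card {V : Type*} [Fintype V] {G : SimpleGraph V} {D : Finset V}
    (hD : IsDominating G (D : Set V)) : dominationNumber V G ≤ D.card :=
  Nat.sInf_le ⟨D, hD, rfl⟩

theorem exists_isDominating_card_eq {V : Type*} [Fintype V] (G : SimpleGraph V) :
    ∃ D : Finset V, IsDominating G (D : Set V) ∧ D.card = dominationNumber V G :=
  Nat.sInf_mem (s := {n : ℕ | ∃ D : Finset V, IsDominating G (D : Set V) ∧ D.card = n})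
    ⟨_, Finset.univ, fun v => ⟨v, by simp, Or.inl rfl⟩, rfl⟩

/-- The fibre of `v` is not dominated within the cell of `s`: no element of `D` whose first
coordinate is sent to `s` by `f` has a second coordinate dominating `v`. -/
def Uncovered {V W : Type*} (H : SimpleGraph W) (D : Finset (V × W)) (f : V → V)
    (s : V) (v : W) : Prop :=
  ∀ d ∈ D, f d.1 = s → ¬(v = d.2 ∨ H.Adj d.2 v)

open Classical in
/-- The elements of `D` over one cell, with the vertices they miss, project to a dominating set
of `H`. -/
theorem dominationNumber_le_card_cell_add {V W : Type*} [Fintype W] (H : SimpleGraph W)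
    (D : Finset (V × W)) (f : V → V) (s : V) :
    dominationNumber W H ≤ (D.filter fun d => f d.1 = s).card +
      (Finset.univ.filter fun v => Uncovered H D f s v).card := by
  refine (dominationNumber_le_card (D := (D.filter fun d => f d.1 = s).image Prod.snd ∪
    Finset.univ.filter fun v => Uncovered H D f s v) ?_).trans
    ((Finset.card_union_le _ _).trans (Nat.add_le_add_right Finset.card_image_le _))
  intro v
  by_cases hv : Uncovered H D f s v
  · exact ⟨v, by simp [hv], Or.inl rfl⟩
  · simp only [Uncovered, not_forall, not_not] at hv
    obtain ⟨d, hd, hs, h⟩ := hv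
    refine ⟨d.2, ?_, h⟩
    simp only [Finset.coe_union, Finset.coe_image, Set.mem_union]
    exact Or.inl ⟨d, by simp [hd, hs], rfl⟩

open Classical in
/-- In the fibre over `v`, the number of uncovered cells is at most the number of elements
of `D`. -/
theorem card_uncovered_le_card_fiber {V W : Type*} [Fintype V]
    {G : SimpleGraph V} {H : SimpleGraph W} {D : Finset (V × W)}
    (hD : IsDominating (G □ H) (D : Set (V × W))) {S : Finset V}
    (hS : S.card = dominationNumber V G) {f : V → V} (hfS : ∀ x, f x ∈ S)
    (hf : ∀ x, x = f x ∨ G.Adj (f x) x) (v : W) :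
    (S.filter fun s => Uncovered H D f s v).card ≤ (D.filter fun d => d.2 = v).card := by
  have key : S.card ≤ (D.filter fun d => d.2 = v).card +
      (S.filter fun s => ¬ Uncovered H D f s v).card := by
    rw [hS]
    refine (dominationNumber_le_card (D := (D.filter fun d => d.2 = v).image Prod.fst ∪
      S.filter fun s => ¬ Uncovered H D f s v) ?_).trans
      ((Finset.card_union_le _ _).trans (Nat.add_le_add_right Finset.card_image_le _))
    intro x
    by_cases hx : Uncovered H D f (f x) v
    · obtain ⟨d, hd, h⟩ := hD (x, v)
      have hd' : d ∈ D := hd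
      have hdx := hx d hd'
      have main : d.2 = v ∧ (x = d.1 ∨ G.Adj d.1 x) := by
        rcases h with rfl | h
        · exact ⟨rfl, Or.inl rfl⟩
        · rw [boxProd_adj] at h
          rcases h with ⟨h, h'⟩ | ⟨h, h'⟩
          · exact ⟨h', Or.inr h⟩
          · exact absurd (Or.inr h) (hdx (congrArg f h'))
      refine ⟨d.1, ?_, main.2⟩
      simp only [Finset.coe_union, Finset.coe_image, Set.mem_union]
      exact Or.inl ⟨d, by simp [hd', main.1], rfl⟩
    · exact ⟨f x, by simp [hx, hfS], hf x⟩
  have := Finset.card_filter_add_card_filter_not (s := S) (fun s => Uncovered H D f s v)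
  omega

theorem dominationNumber_mul_le_two_mul_boxProd {V W : Type*} [Fintype V] [Fintype W]
    (G : SimpleGraph V) (H : SimpleGraph W) :
    dominationNumber V G * dominationNumber W H ≤ 2 * dominationNumber (V × W) (G □ H) := by
  classical
  obtain ⟨D, hD, hDcard⟩ := exists_isDominating_card_eq (G □ H)
  obtain ⟨S, hSdom, hS⟩ := exists_isDominating_card_eq G
  choose f hfS hf using hSdom
  have hcells : ∑ s ∈ S, (D.filter fun d => f d.1 = s).card = D.card :=
    (Finset.card_eq_sum_card_fiberwise fun d _ => hfS d.1).symm
  have hfibers : ∑ v : W, (D.filter fun d => d.2 = v).card = D.card :=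
    (Finset.card_eq_sum_card_fiberwise fun d _ => Finset.mem_coe.2 (Finset.mem_univ d.2)).symm
  calc dominationNumber V G * dominationNumber W H
      = ∑ _s ∈ S, dominationNumber W H := by rw [Finset.sum_const, hS, smul_eq_mul]
    _ ≤ ∑ s ∈ S, ((D.filter fun d => f d.1 = s).card +
          (Finset.univ.filter fun v => Uncovered H D f s v).card) :=
        Finset.sum_le_sum fun s _ => dominationNumber_le_card_cell_add H D f s
    _ = D.card + ∑ v : W, (S.filter fun s => Uncovered H D f s v).card := by
        rw [Finset.sum_add_distrib, hcells]
        exact congrArg _ (Finset.sum_card_bipartiteAbove_eq_sum_card_bipartiteBelow _)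
    _ ≤ D.card + ∑ v : W, (D.filter fun d => d.2 = v).card :=
        Nat.add_le_add_left (Finset.sum_le_sum fun v _ =>
          card_uncovered_le_card_fiber hD hS hfS hf v) _
    _ = 2 * dominationNumber (V × W) (G □ H) := by rw [hfibers, hDcard, two_mul]

theorem vizing_half {V W : Type*} [Fintype V] [Fintype W]
    (G : SimpleGraph V) (H : SimpleGraph W) :
    (dominationNumber (V × W) (G □ H) : ℝ) ≥
      (1 / 2) * (dominationNumber V G) * (dominationNumber W H) := by
  have h : (dominationNumber V G * dominationNumber W H : ℝ) ≤
      2 * dominationNumber (V × W) (G □ H) := by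
    exact_mod_cast dominationNumber_mul_le_two_mul_boxProd G H
  linarith
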